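/- Fix ι ∈ {0,1} and let θ : [0,∞) → ℝ ∪ {+∞} be proper, lower semicontinuous, and strictly convex on its effective domain. Let π* ∈ Π_ι be a minimizer of π ↦ D_θ(ν_ῑ^{(π)}‖ν_ῑ) over Π_ι, and assume the minimal value D_θ(ν_ῑ^{(π*)}‖ν_ῑ) is finite. Then π* is level-optimal maximin. -/

import Mathlib

/- STATEMENT 7: Strictly convex minimizers are level-optimal maximin
(Theorem `strict_convex_implies_level_opt_maximin`).  The side `ι ∈ {0,1}` is formalized
abstractly: `X` plays the role of `Ω_ι` and `Y` of `Ω_ῑ`. -/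

open MeasureTheory ProbabilityTheory Filter
open scoped ENNReal NNReal

noncomputable section

/-- The nonnegative part of an extended real number, as an element of `ℝ≥0∞`. -/
def erealToENNReal (a : EReal) : ℝ≥0∞ :=
  if a = ⊤ then ⊤ else ENNReal.ofReal a.toReal

/-- Extended-real integral via positive/negative parts. -/
def erealIntegral {Ω : Type} [MeasurableSpace Ω] (μ : Measure Ω) (f : Ω → EReal) : EReal :=
  ((∫⁻ x, erealToENNReal (f x) ∂μ : ℝ≥0∞) : EReal)
    - ((∫⁻ x, erealToENNReal (-f x) ∂μ : ℝ≥0∞) : EReal)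

/-- Recession slope of `θ`, i.e. `lim_{t → ∞} θ t / t`. -/
def recessionSlope (θ : ℝ → EReal) : EReal :=
  Filter.limsup (fun t : ℝ => θ t * ((t⁻¹ : ℝ) : EReal)) Filter.atTop

/-- The `θ`-divergence `D_θ(P‖Q) = ∫ θ(dP_ac/dQ) dQ + θ'_∞ · P⊥(Ω)`. -/
def thetaDiv {Ω : Type} [MeasurableSpace Ω] (θ : ℝ → EReal) (P Q : Measure Ω) : EReal :=
  erealIntegral Q (fun x => θ ((P.rnDeriv Q x).toReal))
    + recessionSlope θ * ((P.singularPart Q Set.univ : ℝ≥0∞) : EReal)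

/-- `θ : [0,∞) → ℝ ∪ {+∞}` is proper, convex and lower semicontinuous. -/
structure ProperConvexLSCOn (θ : ℝ → EReal) : Prop where
  ne_bot : ∀ x : ℝ, 0 ≤ x → θ x ≠ ⊥
  exists_ne_top : ∃ x : ℝ, 0 ≤ x ∧ θ x ≠ ⊤
  convex : ∀ x y a b : ℝ, 0 ≤ x → 0 ≤ y → 0 ≤ a → 0 ≤ b → a + b = 1 →
    θ (a * x + b * y) ≤ (a : EReal) * θ x + (b : EReal) * θ y
  lsc : LowerSemicontinuousOn θ (Set.Ici 0)

/-- `θ` is strictly convex on its effective domain (within `[0,∞)`). -/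
def StrictlyConvexOnDom (θ : ℝ → EReal) : Prop :=
  ∀ x y a b : ℝ, 0 ≤ x → 0 ≤ y → x ≠ y → θ x ≠ ⊤ → θ y ≠ ⊤ → 0 < a → 0 < b → a + b = 1 →
    θ (a * x + b * y) < (a : EReal) * θ x + (b : EReal) * θ y

variable {X Y : Type} [MeasurableSpace X] [MeasurableSpace Y]

/-- Refinements of `νX` on side `X`: finite plans concentrated on `E` with `X`-marginal `νX`. -/
def Plans (E : Set (X × Y)) (νX : Measure X) : Set (Measure (X × Y)) :=
  {π | IsFiniteMeasure π ∧ π Eᶜ = 0 ∧ π.map Prod.fst = νX}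

/-- Refinements of `νY` on side `Y`. -/
def PlansSnd (E : Set (X × Y)) (νY : Measure Y) : Set (Measure (X × Y)) :=
  {π | IsFiniteMeasure π ∧ π Eᶜ = 0 ∧ π.map Prod.snd = νY}

/-- Capped feasible subplans at level `t`. -/
def Feas (E : Set (X × Y)) (νX : Measure X) (νY : Measure Y) (t : ℝ) :
    Set (Measure (X × Y)) :=
  {σ | IsFiniteMeasure σ ∧ σ Eᶜ = 0 ∧ σ.map Prod.fst ≤ νX ∧
    σ.map Prod.snd ≤ (ENNReal.ofReal t) • νY}

/-- Maximal feasible mass at level `t`. -/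
def Fit (E : Set (X × Y)) (νX : Measure X) (νY : Measure Y) (t : ℝ) : ℝ≥0∞ :=
  ⨆ σ ∈ Feas E νX νY t, σ Set.univ

/-- Level-optimal maximin: at every level `t > 0` the truncated opposite marginal mass
realizes the maximal feasible mass. -/
def LevelOptMaximin (E : Set (X × Y)) (νX : Measure X) (νY : Measure Y)
    (π : Measure (X × Y)) : Prop :=
  ∀ t : ℝ, 0 < t →
    ∫⁻ y, min ((π.map Prod.snd).rnDeriv νY y) (ENNReal.ofReal t) ∂νY = Fit E νX νY t

section ConvexFunction

variable {θ : ℝ → EReal}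

/-- On its effective domain, `θ` is a real-valued strictly convex function. -/
lemma strictConvexOn_toReal (hθ : ProperConvexLSCOn θ) (hθs : StrictlyConvexOnDom θ) :
    StrictConvexOn ℝ {x | 0 ≤ x ∧ θ x ≠ ⊤} (fun x => (θ x).toReal) := by
  have key : ∀ x y a b : ℝ, 0 ≤ x → 0 ≤ y → θ x ≠ ⊤ → θ y ≠ ⊤ →
      (a : EReal) * θ x + (b : EReal) * θ y
        = ((a * (θ x).toReal + b * (θ y).toReal : ℝ) : EReal) := by
    intro x y a b hx hy hx' hy'
    rw [EReal.coe_add, EReal.coe_mul, EReal.coe_mul, EReal.coe_toReal hx' (hθ.ne_bot x hx),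
      EReal.coe_toReal hy' (hθ.ne_bot y hy)]
  refine ⟨?_, ?_⟩
  · intro x hx y hy a b ha hb hab
    have h0 : 0 ≤ a * x + b * y := add_nonneg (mul_nonneg ha hx.1) (mul_nonneg hb hy.1)
    refine ⟨h0, ne_top_of_le_ne_top ?_ (hθ.convex x y a b hx.1 hy.1 ha hb hab)⟩
    rw [key x y a b hx.1 hy.1 hx.2 hy.2]
    exact EReal.coe_ne_top _
  · intro x hx y hy hxy a b ha hb hab
    have h0 : 0 ≤ a * x + b * y :=
      add_nonneg (mul_nonneg ha.le hx.1) (mul_nonneg hb.le hy.1)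
    have h := hθs x y a b hx.1 hy.1 hxy hx.2 hy.2 ha hb hab
    rw [key x y a b hx.1 hy.1 hx.2 hy.2] at h
    rw [← EReal.coe_toReal h.ne_top (hθ.ne_bot _ h0), EReal.coe_lt_coe_iff] at h
    simpa [smul_eq_mul] using h

/-- A convex function on a real set has a supporting line at interior points. -/
lemma ConvexOn.exists_supporting_line {D : Set ℝ} {f : ℝ → ℝ} (hf : ConvexOn ℝ D f) {u : ℝ}
    (hu : u ∈ interior D) : ∃ m : ℝ, ∀ x ∈ D, f u + m * (x - u) ≤ f x := by
  refine ⟨derivWithin f (Set.Ioi u) u, fun x hx => ?_⟩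
  rcases lt_trichotomy x u with h | rfl | h
  · have h1 := (hf.slope_le_leftDeriv_of_mem_interior hx hu h).trans
      (hf.leftDeriv_le_rightDeriv_of_mem_interior hu)
    rw [slope_def_field, div_le_iff₀ (sub_pos.2 h)] at h1
    linarith
  · simp
  · have h1 := hf.rightDeriv_le_slope_of_mem_interior hu hx h
    rw [slope_def_field, le_div_iff₀ (sub_pos.2 h)] at h1
    linarith

/-- A strictly convex function which is nonnegative and vanishes at `u` strictly contracts when
its argument moves towards `u`. -/
lemma StrictConvexOn.lt_of_between {D : Set ℝ} {h : ℝ → ℝ} (hh : StrictConvexOn ℝ D h)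
    {u x y : ℝ} (hu : u ∈ D) (hx : x ∈ D) (hu0 : h u = 0) (h0 : ∀ z ∈ D, 0 ≤ h z)
    (hy : y ∈ segment ℝ x u) (hxy : y ≠ x) : y ∈ D ∧ h y < h x := by
  have hyD := hh.1.segment_subset hx hu hy
  refine ⟨hyD, ?_⟩
  have hxu : x ≠ u := by
    rintro rfl
    rw [segment_same] at hy
    exact hxy hy
  have hpos : 0 < h x := by
    refine lt_of_le_of_ne (h0 x hx) fun he => hxu ?_
    exact hh.eq_of_isMinOn (fun z hz => by simpa [← he] using h0 z hz)
      (fun z hz => by simpa [hu0] using h0 z hz) hx hu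
  obtain ⟨a, b, ha, hb, hab, rfl⟩ := hy
  have hc := hh.convexOn.2 hx hu ha hb hab
  rw [hu0] at hc
  simp only [smul_eq_mul, mul_zero, add_zero] at hc hxy ⊢
  have ha1 : a < 1 := by
    refine lt_of_le_of_ne (by linarith) fun he => hxy ?_
    have : b = 0 := by linarith
    simp [he, this]
  nlinarith

lemma ProperConvexLSCOn.measurable_max (hθ : ProperConvexLSCOn θ) :
    Measurable fun x : ℝ => θ (max x 0) := by
  have h : LowerSemicontinuousOn (θ ∘ fun x : ℝ => max x 0) Set.univ :=
    hθ.lsc.comp (by fun_prop) (fun x _ => le_max_right x 0)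
  exact (lowerSemicontinuousOn_univ_iff.1 h).measurable

/-- The amount by which `θ` exceeds the affine function `x ↦ m * x + c` on `[0, ∞)`. -/
def affineGap (θ : ℝ → EReal) (m c x : ℝ) : ℝ≥0∞ :=
  (θ (max x 0) - ((m * x + c : ℝ) : EReal)).toENNReal

lemma measurable_affineGap (hθ : ProperConvexLSCOn θ) (m c : ℝ) :
    Measurable (affineGap θ m c) := by
  refine Measurable.ereal_toENNReal ?_
  have h1 : Measurable fun x : ℝ => ((-(m * x + c) : ℝ) : EReal) :=
    measurable_coe_real_ereal.comp (by fun_prop)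
  simp_rw [sub_eq_add_neg, ← EReal.coe_neg]
  exact hθ.measurable_max.add h1

lemma affineGap_eq_top_iff {m c x : ℝ} (hx : 0 ≤ x) : affineGap θ m c x = ⊤ ↔ θ x = ⊤ := by
  rw [affineGap, max_eq_left hx, EReal.toENNReal_eq_top_iff]
  generalize m * x + c = a
  induction θ x with
  | bot => simp
  | top => simp
  | coe t => simp [← EReal.coe_sub]

lemma eq_affine_add_gap {m c x : ℝ} (hx : 0 ≤ x) (h : ((m * x + c : ℝ) : EReal) ≤ θ x) :
    θ x = ((m * x + c : ℝ) : EReal) + (affineGap θ m c x : EReal) := by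
  rw [affineGap, max_eq_left hx]
  generalize m * x + c = a at h ⊢
  generalize θ x = t at h ⊢
  rw [EReal.coe_toENNReal (EReal.sub_nonneg (by simp) (by simp) |>.2 h)]
  induction t with
  | bot => exact absurd (le_bot_iff.1 h) (EReal.coe_ne_bot a)
  | top => simp
  | coe t => rw [← EReal.coe_sub, ← EReal.coe_add, add_sub_cancel]

/-- There is an affine minorant of `θ` touching it at `u`, the gap between the two being monotone
on both sides of `u`. -/
lemma exists_affine_minorant_of_between (hθ : ProperConvexLSCOn θ) (hθs : StrictlyConvexOnDom θ)
    {w u z : ℝ} (hw : 0 ≤ w) (hwt : θ w ≠ ⊤) (hwu : w < u) (huz : u < z) (hzt : θ z ≠ ⊤) :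
    ∃ m c : ℝ, (∀ x, 0 ≤ x → ((m * x + c : ℝ) : EReal) ≤ θ x) ∧
      (∀ x y, 0 ≤ x → θ x ≠ ⊤ → x < y → y ≤ u → affineGap θ m c y < affineGap θ m c x) ∧
      (∀ x y, u ≤ y → y ≤ x → affineGap θ m c y ≤ affineGap θ m c x) := by
  set D : Set ℝ := {x | 0 ≤ x ∧ θ x ≠ ⊤} with hD
  have hf := strictConvexOn_toReal hθ hθs
  have hwD : w ∈ D := ⟨hw, hwt⟩
  have hzD : z ∈ D := ⟨(hw.trans hwu.le).trans huz.le, hzt⟩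
  have huI : u ∈ interior D := by
    refine mem_interior.2 ⟨Set.Ioo w z, ?_, isOpen_Ioo, hwu, huz⟩
    exact Set.Ioo_subset_Icc_self.trans (hf.1.ordConnected.out hwD hzD)
  have huD : u ∈ D := interior_subset huI
  obtain ⟨m, hm⟩ := hf.convexOn.exists_supporting_line huI
  set c : ℝ := (θ u).toReal - m * u with hc
  set h : ℝ → ℝ := fun x => (θ x).toReal - (m * x + c) with hh
  have hconv : StrictConvexOn ℝ D h := by
    refine hf.sub_concaveOn ⟨hf.1, fun x _ y _ a b _ _ hab => ?_⟩
    simp only [smul_eq_mul]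
    have : c = a * c + b * c := by rw [← add_mul, hab, one_mul]
    nlinarith
  have hu0 : h u = 0 := by simp only [hh, hc]; ring
  have h0 : ∀ x ∈ D, 0 ≤ h x := fun x hx => by
    have := hm x hx
    simp only [hh, hc]; linarith
  have hGD : ∀ x ∈ D, affineGap θ m c x = ENNReal.ofReal (h x) := by
    intro x hx
    simp only [affineGap, hh, max_eq_left hx.1]
    rw [← EReal.real_coe_toENNReal, EReal.coe_sub, EReal.coe_toReal hx.2 (hθ.ne_bot x hx.1)]
  refine ⟨m, c, ?_, ?_, ?_⟩
  · intro x hx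
    by_cases hxt : θ x = ⊤
    · simp [hxt]
    · rw [← EReal.coe_toReal hxt (hθ.ne_bot x hx), EReal.coe_le_coe_iff]
      exact sub_nonneg.1 (h0 x ⟨hx, hxt⟩)
  · intro x y hx hxt hxy hyu
    obtain ⟨hyD, hlt⟩ := hconv.lt_of_between huD ⟨hx, hxt⟩ hu0 h0
      (by rw [segment_eq_Icc (hxy.le.trans hyu)]; exact ⟨hxy.le, hyu⟩) hxy.ne'
    rw [hGD x ⟨hx, hxt⟩, hGD y hyD]
    exact (ENNReal.ofReal_lt_ofReal_iff_of_nonneg (h0 y hyD)).2 hlt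
  · intro x y huy hyx
    rcases hyx.eq_or_lt with rfl | hyx
    · exact le_rfl
    have hx : 0 ≤ x := huD.1.trans (huy.trans hyx.le)
    by_cases hxt : θ x = ⊤
    · rw [(affineGap_eq_top_iff hx).2 hxt]
      exact le_top
    · obtain ⟨hyD, hlt⟩ := hconv.lt_of_between huD ⟨hx, hxt⟩ hu0 h0
        (by rw [segment_symm, segment_eq_Icc (huy.trans hyx.le)]; exact ⟨huy, hyx.le⟩) hyx.ne
      rw [hGD x ⟨hx, hxt⟩, hGD y hyD]
      exact ENNReal.ofReal_le_ofReal hlt.le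

lemma le_recessionSlope {m c : ℝ} (h : ∀ x, 0 ≤ x → ((m * x + c : ℝ) : EReal) ≤ θ x) :
    (m : EReal) ≤ recessionSlope θ := by
  have hlim : Tendsto (fun t : ℝ => ((m + c * t⁻¹ : ℝ) : EReal)) atTop (nhds (m : EReal)) := by
    refine (continuous_coe_real_ereal.tendsto m).comp ?_
    simpa using (tendsto_inv_atTop_zero (𝕜 := ℝ)).const_mul c |>.const_add m
  rw [← hlim.limsup_eq]
  refine limsup_le_limsup ?_
  filter_upwards [eventually_gt_atTop 0] with t ht
  have h1 : ((m + c * t⁻¹ : ℝ) : EReal) = ((m * t + c : ℝ) : EReal) * ((t⁻¹ : ℝ) : EReal) := by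
    rw [← EReal.coe_mul]
    congr 1
    field_simp
  rw [h1]
  exact mul_le_mul_of_nonneg_right (h t ht.le) (by exact_mod_cast (inv_pos.2 ht).le)

lemma exists_gt_ne_top_of_recessionSlope_ne_top (h : recessionSlope θ ≠ ⊤) (u : ℝ) :
    ∃ z, u < z ∧ θ z ≠ ⊤ := by
  by_contra! hcon
  refine h ?_
  have : (fun t : ℝ => θ t * ((t⁻¹ : ℝ) : EReal)) =ᶠ[atTop] fun _ => ⊤ := by
    filter_upwards [eventually_gt_atTop u, eventually_gt_atTop 0] with t ht ht0
    rw [hcon t ht]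
    exact EReal.top_mul_coe_of_pos (inv_pos.2 ht0)
  rw [recessionSlope, limsup_congr this, limsup_const]

lemma exists_affine_minorant (hθ : ProperConvexLSCOn θ) (hθs : StrictlyConvexOnDom θ) :
    ∃ m c : ℝ, ∀ x, 0 ≤ x → ((m * x + c : ℝ) : EReal) ≤ θ x := by
  obtain ⟨w, hw, hwt⟩ := hθ.exists_ne_top
  by_cases hex : ∃ z, 0 ≤ z ∧ θ z ≠ ⊤ ∧ z ≠ w
  · obtain ⟨z, hz, hzt, hzw⟩ := hex
    rcases hzw.lt_or_gt with h | h
    · obtain ⟨u, h1, h2⟩ := exists_between h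
      obtain ⟨m, c, hmc, -⟩ := exists_affine_minorant_of_between hθ hθs hz hzt h1 h2 hwt
      exact ⟨m, c, hmc⟩
    · obtain ⟨u, h1, h2⟩ := exists_between h
      obtain ⟨m, c, hmc, -⟩ := exists_affine_minorant_of_between hθ hθs hw hwt h1 h2 hzt
      exact ⟨m, c, hmc⟩
  · push Not at hex
    refine ⟨0, (θ w).toReal, fun x hx => ?_⟩
    rw [zero_mul, zero_add, EReal.coe_toReal hwt (hθ.ne_bot w hw)]
    by_cases hxt : θ x = ⊤
    · simp [hxt]
    · rw [hex x hx hxt]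

end ConvexFunction

section Divergence

variable {Ω : Type} [MeasurableSpace Ω]

lemma erealToENNReal_add_ofReal_neg (h : ℝ) (g : ℝ≥0∞) :
    erealToENNReal ((h : EReal) + (g : EReal)) + ENNReal.ofReal (-h)
      = erealToENNReal (-((h : EReal) + (g : EReal))) + (ENNReal.ofReal h + g) := by
  change (_ : EReal).toENNReal + _ = (_ : EReal).toENNReal + _
  induction g with
  | top => simp
  | coe g =>
    rw [← EReal.coe_ennreal_toReal ENNReal.coe_ne_top, ENNReal.coe_toReal, ← EReal.coe_add,
      ← EReal.coe_neg, EReal.real_coe_toENNReal, EReal.real_coe_toENNReal]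
    refine (ENNReal.toReal_eq_toReal_iff' (by simp) (by simp)).1 ?_
    rw [ENNReal.toReal_add (by simp) (by simp), ENNReal.toReal_add (by simp) (by simp),
      ENNReal.toReal_add (by simp) (by simp), ENNReal.toReal_ofReal', ENNReal.toReal_ofReal',
      ENNReal.toReal_ofReal', ENNReal.toReal_ofReal', ENNReal.coe_toReal]
    have hg := g.2
    rcases le_total 0 (h + g) with h1 | h1 <;> rcases le_total 0 h with h2 | h2 <;>
      simp only [max_eq_left, max_eq_right, h1, h2, neg_nonneg, neg_nonpos] <;> linarith

lemma erealToENNReal_neg_le (h : ℝ) (g : ℝ≥0∞) :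
    erealToENNReal (-((h : EReal) + (g : EReal))) ≤ ENNReal.ofReal (-h) := by
  change (_ : EReal).toENNReal ≤ _
  rw [← EReal.real_coe_toENNReal, EReal.coe_neg]
  refine EReal.toENNReal_le_toENNReal (EReal.neg_le_neg_iff.2 ?_)
  exact le_add_of_nonneg_right (EReal.coe_ennreal_nonneg g)

lemma erealIntegral_real_add_ennreal {μ : Measure Ω} {f : Ω → EReal} {h : Ω → ℝ}
    {G : Ω → ℝ≥0∞} (hh : Integrable h μ) (hG : Measurable G)
    (hf : ∀ x, f x = (h x : EReal) + (G x : EReal)) :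
    erealIntegral μ f = ((∫ x, h x ∂μ : ℝ) : EReal) + ((∫⁻ x, G x ∂μ : ℝ≥0∞) : EReal) := by
  have hm : AEMeasurable (fun x => ENNReal.ofReal (-h x)) μ :=
    hh.aemeasurable.neg.ennreal_ofReal
  have hm' : AEMeasurable (fun x => ENNReal.ofReal (h x) + G x) μ :=
    hh.aemeasurable.ennreal_ofReal.add hG.aemeasurable
  have hsum : (∫⁻ x, erealToENNReal (f x) ∂μ) + ∫⁻ x, ENNReal.ofReal (-h x) ∂μ
      = (∫⁻ x, erealToENNReal (-f x) ∂μ)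
        + ((∫⁻ x, ENNReal.ofReal (h x) ∂μ) + ∫⁻ x, G x ∂μ) := by
    rw [← lintegral_add_right' _ hm, ← lintegral_add_right _ hG,
      ← lintegral_add_right' _ hm']
    refine lintegral_congr fun x => ?_
    rw [hf x]
    exact erealToENNReal_add_ofReal_neg (h x) (G x)
  have hn : ∫⁻ x, ENNReal.ofReal (-h x) ∂μ ≠ ⊤ := hh.neg.lintegral_lt_top.ne
  have hp : ∫⁻ x, ENNReal.ofReal (h x) ∂μ ≠ ⊤ := hh.lintegral_lt_top.ne
  have hb : ∫⁻ x, erealToENNReal (-f x) ∂μ ≠ ⊤ := by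
    refine ne_top_of_le_ne_top hn (lintegral_mono fun x => ?_)
    rw [hf x]
    exact erealToENNReal_neg_le (h x) (G x)
  rw [erealIntegral, integral_eq_lintegral_pos_part_sub_lintegral_neg_part hh]
  generalize ∫⁻ x, erealToENNReal (f x) ∂μ = a at *
  generalize ∫⁻ x, erealToENNReal (-f x) ∂μ = b at *
  generalize ∫⁻ x, ENNReal.ofReal (-h x) ∂μ = n at *
  generalize ∫⁻ x, ENNReal.ofReal (h x) ∂μ = p at *
  generalize ∫⁻ x, G x ∂μ = g at *
  rw [← EReal.coe_ennreal_toReal hb]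
  by_cases hg : g = ⊤
  · have ha : a = ⊤ := by
      by_contra ha
      rw [hg, add_top, add_top] at hsum
      exact ENNReal.add_ne_top.2 ⟨ha, hn⟩ hsum
    rw [ha, hg, EReal.coe_ennreal_top, EReal.top_sub_coe, EReal.coe_add_top]
  · have ha : a ≠ ⊤ := fun ha => by
      rw [ha, top_add] at hsum
      exact ENNReal.add_ne_top.2 ⟨hb, ENNReal.add_ne_top.2 ⟨hp, hg⟩⟩ hsum.symm
    rw [← EReal.coe_ennreal_toReal ha, ← EReal.coe_ennreal_toReal hg, ← EReal.coe_sub,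
      ← EReal.coe_add, EReal.coe_eq_coe_iff]
    have := congrArg ENNReal.toReal hsum
    rw [ENNReal.toReal_add ha hn, ENNReal.toReal_add hb (ENNReal.add_ne_top.2 ⟨hp, hg⟩),
      ENNReal.toReal_add hp hg] at this
    linarith

variable {θ : ℝ → EReal}

/-- The divergence in terms of an affine minorant of `θ`. -/
lemma thetaDiv_eq (hθ : ProperConvexLSCOn θ) {m c : ℝ}
    (hmc : ∀ x, 0 ≤ x → ((m * x + c : ℝ) : EReal) ≤ θ x) (P ν : Measure Ω) [IsFiniteMeasure P]
    [IsFiniteMeasure ν] :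
    thetaDiv θ P ν = ((m * (∫⁻ y, P.rnDeriv ν y ∂ν).toReal + c * ν.real Set.univ : ℝ) : EReal)
      + ((∫⁻ y, affineGap θ m c (P.rnDeriv ν y).toReal ∂ν : ℝ≥0∞) : EReal)
      + recessionSlope θ * ((P.singularPart ν Set.univ : ℝ≥0∞) : EReal) := by
  have hint : Integrable (fun y => (P.rnDeriv ν y).toReal) ν :=
    Measure.integrable_toReal_rnDeriv
  rw [thetaDiv, erealIntegral_real_add_ennreal (h := fun y => m * (P.rnDeriv ν y).toReal + c)
    (G := fun y => affineGap θ m c (P.rnDeriv ν y).toReal)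
    ((hint.const_mul m).add (integrable_const c))
    ((measurable_affineGap hθ m c).comp (Measure.measurable_rnDeriv P ν).ennreal_toReal)
    fun y => eq_affine_add_gap ENNReal.toReal_nonneg (hmc _ ENNReal.toReal_nonneg)]
  rw [integral_add (hint.const_mul m) (integrable_const c), integral_const_mul,
    integral_toReal (Measure.measurable_rnDeriv P ν).aemeasurable (Measure.rnDeriv_lt_top P ν),
    integral_const, smul_eq_mul, mul_comm (ν.real Set.univ) c]

lemma lintegral_rnDeriv_add_singularPart (P ν : Measure Ω) [IsFiniteMeasure P]
    [IsFiniteMeasure ν] :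
    (∫⁻ y, P.rnDeriv ν y ∂ν) + P.singularPart ν Set.univ = P Set.univ := by
  conv_rhs => rw [← Measure.rnDeriv_add_singularPart P ν]
  simp

end Divergence

section Perturbation

lemma ereal_ne_top_of_add_mul_ne_top {x : ℝ} {g S : ℝ≥0∞} {s : EReal} (hs : s ≠ ⊥)
    (hS : S ≠ ⊤) (h : (x : EReal) + (g : EReal) + s * (S : EReal) ≠ ⊤) :
    g ≠ ⊤ ∧ (s = ⊤ → S = 0) := by
  have hbot : s * (S : EReal) ≠ ⊥ := by
    rw [← EReal.coe_ennreal_toReal hS]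
    induction s with
    | bot => exact absurd rfl hs
    | coe s => rw [← EReal.coe_mul]; exact EReal.coe_ne_bot _
    | top =>
      rcases (ENNReal.toReal_nonneg (a := S)).eq_or_lt with h0 | h0
      · simp [← h0]
      · rw [EReal.top_mul_coe_of_pos h0]; simp
  constructor
  · rintro rfl
    refine h ?_
    rw [EReal.coe_ennreal_top, EReal.coe_add_top, EReal.top_add_of_ne_bot hbot]
  · rintro rfl
    by_contra hS0
    refine h ?_
    rw [← EReal.coe_ennreal_toReal hS, EReal.top_mul_coe_of_pos (ENNReal.toReal_pos hS0 hS)]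
    refine EReal.add_top_of_ne_bot ?_
    exact EReal.add_ne_bot_iff.2 ⟨EReal.coe_ne_bot x, EReal.coe_ennreal_ne_bot g⟩

/-- If mass is exchanged between an affine term of slope `m` and a term of slope `s ≥ m`, and the
total does not decrease, then neither does the remaining term. -/
lemma ereal_le_of_affine_add_mul_le {m d R R' S S' : ℝ} {s : EReal} {g g' : ℝ≥0∞}
    (hms : (m : EReal) ≤ s) (hg : g ≠ ⊤) (hs : s = ⊤ → S = 0) (hS : 0 ≤ S') (hSS : S' ≤ S)
    (hRS : R + S = R' + S')
    (h : ((m * R + d : ℝ) : EReal) + (g : EReal) + s * (S : EReal)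
      ≤ ((m * R' + d : ℝ) : EReal) + (g' : EReal) + s * (S' : EReal)) : g ≤ g' := by
  by_cases hg' : g' = ⊤
  · simp [hg']
  rw [← EReal.coe_ennreal_toReal hg, ← EReal.coe_ennreal_toReal hg'] at h
  rw [← ENNReal.toReal_le_toReal hg hg']
  induction s with
  | bot => simp at hms
  | coe s =>
    simp only [← EReal.coe_mul, ← EReal.coe_add, EReal.coe_le_coe_iff] at h hms
    have hR : R = R' + S' - S := by linarith
    rw [hR] at h
    nlinarith [mul_nonneg (sub_nonneg.2 hms) (sub_nonneg.2 hSS)]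
  | top =>
    have hS0 := hs rfl
    have hS0' : S' = 0 := le_antisymm (hSS.trans hS0.le) hS
    rw [hS0, hS0'] at h
    simp only [EReal.coe_zero, mul_zero, add_zero, ← EReal.coe_add, EReal.coe_le_coe_iff] at h
    have : R = R' := by linarith
    rw [this] at h
    linarith

variable {Ω : Type} [MeasurableSpace Ω] {θ : ℝ → EReal}

/-- Moving mass from where the density is (and stays) at least `u` to where it is (and stays) at
most `u` strictly decreases the divergence. -/
lemma eq_zero_of_thetaDiv_le (hθ : ProperConvexLSCOn θ) (hθs : StrictlyConvexOnDom θ)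
    {ν P₁ A B : Measure Ω} [IsFiniteMeasure ν] [IsFiniteMeasure P₁] [IsFiniteMeasure A]
    [IsFiniteMeasure B] (hBν : B ≪ ν) (hAB : A Set.univ = B Set.univ) {u : ℝ}
    (hA : ∀ᵐ y ∂ν, A.rnDeriv ν y ≠ 0 → ENNReal.ofReal u ≤ P₁.rnDeriv ν y)
    (hB : ∀ᵐ y ∂ν, B.rnDeriv ν y ≠ 0 →
      A.rnDeriv ν y = 0 ∧ P₁.rnDeriv ν y + B.rnDeriv ν y ≤ ENNReal.ofReal u)
    (hfin : thetaDiv θ (P₁ + A) ν ≠ ⊤)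
    (hle : thetaDiv θ (P₁ + A) ν ≤ thetaDiv θ (P₁ + B) ν) : B = 0 := by
  by_contra hB0
  have hfreq : ∃ᶠ y in ae ν, B.rnDeriv ν y ≠ 0 := by
    intro hev
    refine hB0 ?_
    rw [← Measure.withDensity_rnDeriv_eq B ν hBν]
    refine (withDensity_eq_zero_iff (Measure.measurable_rnDeriv B ν).aemeasurable).2 ?_
    filter_upwards [hev] with y hy
    simpa using hy
  set r := (P₁ + A).rnDeriv ν with hr
  set r' := (P₁ + B).rnDeriv ν with hr'
  have hbase : ∀ᵐ y ∂ν, r y = P₁.rnDeriv ν y + A.rnDeriv ν y ∧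
      r' y = P₁.rnDeriv ν y + B.rnDeriv ν y ∧ r y ≠ ⊤ ∧ r' y ≠ ⊤ := by
    filter_upwards [Measure.rnDeriv_add P₁ A ν, Measure.rnDeriv_add P₁ B ν,
      Measure.rnDeriv_ne_top (P₁ + A) ν, Measure.rnDeriv_ne_top (P₁ + B) ν] with y h1 h2 h3 h4
    exact ⟨h1, h2, h3, h4⟩
  have hsing : (P₁ + A).singularPart ν = P₁.singularPart ν + A.singularPart ν :=
    Measure.singularPart_add P₁ A ν
  have hsing' : (P₁ + B).singularPart ν = P₁.singularPart ν := by
    rw [Measure.singularPart_add, Measure.singularPart_eq_zero_of_ac hBν, add_zero]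
  have hStop : (P₁ + A).singularPart ν Set.univ ≠ ⊤ := measure_ne_top _ _
  obtain ⟨m₀, c₀, hmc₀⟩ := exists_affine_minorant hθ hθs
  have hrec₀ : recessionSlope θ ≠ ⊥ := fun h => by simpa [h] using le_recessionSlope hmc₀
  have hθr : ∀ᵐ y ∂ν, θ (r y).toReal ≠ ⊤ := by
    have h := hfin
    rw [thetaDiv_eq hθ hmc₀] at h
    have h1 := (ereal_ne_top_of_add_mul_ne_top hrec₀ hStop h).1
    filter_upwards [ae_lt_top ((measurable_affineGap hθ m₀ c₀).comp
      (Measure.measurable_rnDeriv _ ν).ennreal_toReal) h1] with y hy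
    exact fun ht => hy.ne ((affineGap_eq_top_iff ENNReal.toReal_nonneg).2 ht)
  have hlow : ∀ᵐ y ∂ν, B.rnDeriv ν y ≠ 0 → (r y).toReal < (r' y).toReal ∧ (r' y).toReal ≤ u := by
    filter_upwards [hbase, hB] with y ⟨h1, h2, h3, h4⟩ h5 hy
    obtain ⟨h6, h7⟩ := h5 hy
    rw [← h2] at h7
    have hlt : r y < r' y := by
      rw [h1, h2, h6, add_zero]
      rw [h1, h6, add_zero] at h3
      exact ENNReal.lt_add_right h3 hy
    have hlt' := (ENNReal.toReal_lt_toReal h3 h4).2 hlt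
    refine ⟨hlt', ?_⟩
    have hu : 0 ≤ u := by
      by_contra hu
      rw [ENNReal.ofReal_of_nonpos (not_le.1 hu).le] at h7
      exact (hlt.trans_le h7).not_ge zero_le
    exact (ENNReal.toReal_le_of_le_ofReal hu h7)
  have hhigh : ∀ᵐ y ∂ν, A.rnDeriv ν y ≠ 0 →
      u ≤ (P₁.rnDeriv ν y).toReal ∧ (P₁.rnDeriv ν y).toReal < (r y).toReal := by
    filter_upwards [hbase, hA] with y ⟨h1, h2, h3, h4⟩ h5 hy
    rw [h1] at h3
    have h6 := (ENNReal.add_ne_top.1 h3).1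
    refine ⟨(ENNReal.ofReal_le_iff_le_toReal h6).1 (h5 hy), ?_⟩
    rw [h1]
    exact (ENNReal.toReal_lt_toReal h6 h3).2 (ENNReal.lt_add_right h6 hy)
  obtain ⟨w, hw, hwt, hwu⟩ : ∃ w, 0 ≤ w ∧ θ w ≠ ⊤ ∧ w < u := by
    obtain ⟨y, hy, h1, h2⟩ := (hfreq.and_eventually (hθr.and hlow)).exists
    exact ⟨_, ENNReal.toReal_nonneg, h1, (h2 hy).1.trans_le (h2 hy).2⟩
  obtain ⟨z, huz, hzt⟩ : ∃ z, u < z ∧ θ z ≠ ⊤ := by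
    by_cases hrec : recessionSlope θ = ⊤
    · have h := hfin
      rw [thetaDiv_eq hθ hmc₀] at h
      have h0 := (ereal_ne_top_of_add_mul_ne_top hrec₀ hStop h).2 hrec
      rw [hsing, Measure.add_apply, add_eq_zero] at h0
      have hA0 : ∫⁻ y, A.rnDeriv ν y ∂ν ≠ 0 := by
        have hmass := lintegral_rnDeriv_add_singularPart A ν
        rw [h0.2, add_zero, hAB] at hmass
        rw [hmass]
        exact fun h => hB0 (Measure.measure_univ_eq_zero.1 h)
      have hfreqA : ∃ᶠ y in ae ν, A.rnDeriv ν y ≠ 0 := fun hev =>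
        hA0 ((lintegral_eq_zero_iff (Measure.measurable_rnDeriv A ν)).2
          (hev.mono fun y hy => by simpa using hy))
      obtain ⟨y, hy, h1, h2⟩ := (hfreqA.and_eventually (hθr.and hhigh)).exists
      exact ⟨_, (h2 hy).1.trans_lt (h2 hy).2, h1⟩
    · exact exists_gt_ne_top_of_recessionSlope_ne_top hrec u
  obtain ⟨m, c, hmc, hGlow, hGhigh⟩ :=
    exists_affine_minorant_of_between hθ hθs hw hwt hwu huz hzt
  have hmono : ∀ᵐ y ∂ν, affineGap θ m c (r' y).toReal ≤ affineGap θ m c (r y).toReal := by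
    filter_upwards [hbase, hlow, hhigh, hθr] with y ⟨h1, h2, h3, h4⟩ h5 h6 h7
    by_cases hb : B.rnDeriv ν y = 0
    · by_cases ha : A.rnDeriv ν y = 0
      · rw [h1, h2, ha, hb]
      · rw [h2, hb, add_zero]
        exact hGhigh _ _ (h6 ha).1 (h6 ha).2.le
    · exact (hGlow _ _ ENNReal.toReal_nonneg h7 (h5 hb).1 (h5 hb).2).le
  have hmeas : ∀ P : Measure Ω, Measurable fun y => affineGap θ m c (P.rnDeriv ν y).toReal :=
    fun P => (measurable_affineGap hθ m c).comp (Measure.measurable_rnDeriv P ν).ennreal_toReal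
  rw [thetaDiv_eq hθ hmc] at hfin
  have hg := ereal_ne_top_of_add_mul_ne_top hrec₀ hStop hfin
  have hint : ∫⁻ y, affineGap θ m c (r y).toReal ∂ν ≤ ∫⁻ y, affineGap θ m c (r' y).toReal ∂ν := by
    rw [thetaDiv_eq hθ hmc, thetaDiv_eq hθ hmc, ← EReal.coe_ennreal_toReal hStop,
      ← EReal.coe_ennreal_toReal (measure_ne_top ((P₁ + B).singularPart ν) Set.univ)] at hle
    refine ereal_le_of_affine_add_mul_le (le_recessionSlope hmc) hg.1 (fun h => ?_)
      ENNReal.toReal_nonneg ?_ ?_ hle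
    · rw [hg.2 h, ENNReal.toReal_zero]
    · refine ENNReal.toReal_mono hStop ?_
      rw [hsing, hsing', Measure.add_apply]
      exact le_self_add
    · rw [← ENNReal.toReal_add (Measure.lintegral_rnDeriv_lt_top _ _).ne (measure_ne_top _ _),
        ← ENNReal.toReal_add (Measure.lintegral_rnDeriv_lt_top _ _).ne (measure_ne_top _ _),
        lintegral_rnDeriv_add_singularPart, lintegral_rnDeriv_add_singularPart,
        Measure.add_apply, Measure.add_apply, hAB]
  have heq := ae_eq_of_ae_le_of_lintegral_le hmono
    (ne_top_of_le_ne_top hg.1 (lintegral_mono_ae hmono)) (hmeas _).aemeasurable hint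
  obtain ⟨y, hy, h1, h2, h3⟩ := (hfreq.and_eventually (heq.and (hlow.and hθr))).exists
  exact (hGlow _ _ ENNReal.toReal_nonneg h3 (h2 hy).1 (h2 hy).2).ne h1

end Perturbation

section Exchange

variable {Ω : Type} [MeasurableSpace Ω]

lemma rnDeriv_mono {A P ν : Measure Ω} [IsFiniteMeasure P] [IsFiniteMeasure ν] (h : A ≤ P) :
    A.rnDeriv ν ≤ᵐ[ν] P.rnDeriv ν := by
  have : IsFiniteMeasure A := isFiniteMeasure_of_le P h
  have hadd := Measure.rnDeriv_add A (P - A) ν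
  rw [add_comm A, Measure.sub_add_cancel_of_le h] at hadd
  filter_upwards [hadd] with y hy
  rw [hy]
  exact le_self_add

lemma rnDeriv_le_smul {A P ν : Measure Ω} [IsFiniteMeasure P] [IsFiniteMeasure ν] {c : ℝ≥0∞}
    (hc : c ≠ ⊤) (h : A ≤ c • P) : ∀ᵐ y ∂ν, A.rnDeriv ν y ≤ c * P.rnDeriv ν y := by
  have : IsFiniteMeasure (c • P) := P.smul_finite hc
  filter_upwards [rnDeriv_mono (ν := ν) h, Measure.rnDeriv_smul_left_of_ne_top P ν hc]
    with y h1 h2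
  rw [h2] at h1
  simpa using h1

lemma ae_rnDeriv_eq_zero_of_measure_eq_zero {A ν : Measure Ω} {S : Set Ω}
    (hS : MeasurableSet S) (h : A S = 0) : ∀ᵐ y ∂ν, y ∈ S → A.rnDeriv ν y = 0 := by
  have h1 : ∫⁻ y in S, A.rnDeriv ν y ∂ν = 0 :=
    le_antisymm ((Measure.setLIntegral_rnDeriv_le S).trans h.le) zero_le
  exact (setLIntegral_eq_zero_iff hS (Measure.measurable_rnDeriv A ν)).1 h1

lemma map_withDensity_comp {Ω' : Type} [MeasurableSpace Ω'] (μ : Measure Ω) {f : Ω → Ω'}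
    (hf : Measurable f) {g : Ω' → ℝ≥0∞} (hg : Measurable g) :
    (μ.withDensity fun x => g (f x)).map f = (μ.map f).withDensity g := by
  ext S hS
  rw [Measure.map_apply hf hS, withDensity_apply _ (hf hS), withDensity_apply _ hS,
    setLIntegral_map hS hg hf]

lemma withDensity_le_smul (μ : Measure Ω) {g : Ω → ℝ≥0∞} {c : ℝ≥0∞} (h : ∀ x, g x ≤ c) :
    μ.withDensity g ≤ c • μ := by
  rw [← withDensity_const]
  exact withDensity_mono (ae_of_all _ h)

/-- Density with respect to `νX` of the mass which `ρ` sends into `S ⊆ Y`. -/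
def sendDensity (νX : Measure X) (ρ : Measure (X × Y)) (S : Set Y) : X → ℝ≥0∞ :=
  ((ρ.restrict (Prod.snd ⁻¹' S)).map Prod.fst).rnDeriv νX

lemma measurable_sendDensity (νX : Measure X) (ρ : Measure (X × Y)) (S : Set Y) :
    Measurable (sendDensity νX ρ S) :=
  Measure.measurable_rnDeriv _ _

variable {νX : Measure X} {ρ : Measure (X × Y)} {S : Set Y}

lemma map_restrict_le (hρ : ρ.map Prod.fst ≤ νX) :
    (ρ.restrict (Prod.snd ⁻¹' S)).map Prod.fst ≤ νX :=
  (Measure.map_mono Measure.restrict_le_self measurable_fst).trans hρ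

variable [IsFiniteMeasure νX]

lemma withDensity_sendDensity (hρ : ρ.map Prod.fst ≤ νX) :
    νX.withDensity (sendDensity νX ρ S) = (ρ.restrict (Prod.snd ⁻¹' S)).map Prod.fst := by
  have : IsFiniteMeasure ((ρ.restrict (Prod.snd ⁻¹' S)).map Prod.fst) :=
    isFiniteMeasure_of_le νX (map_restrict_le hρ)
  exact Measure.withDensity_rnDeriv_eq _ _
    (Measure.absolutelyContinuous_of_le (map_restrict_le hρ))

lemma sendDensity_le_one (hρ : ρ.map Prod.fst ≤ νX) :
    ∀ᵐ x ∂νX, sendDensity νX ρ S x ≤ 1 :=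
  Measure.rnDeriv_le_one_of_le (map_restrict_le hρ)

lemma measure_prod_eq_setLIntegral_sendDensity (hρ : ρ.map Prod.fst ≤ νX)
    {Q : Set X} (hQ : MeasurableSet Q) :
    ρ (Q ×ˢ S) = ∫⁻ x in Q, sendDensity νX ρ S x ∂νX := by
  rw [← withDensity_apply _ hQ, withDensity_sendDensity hρ, Measure.map_apply measurable_fst hQ,
    Measure.restrict_apply (measurable_fst hQ), Set.prod_eq]

/-- Up to a factor `ε`, the mass which `π` sends into `H` can be exchanged against the mass which
`σ` sends into `L` from the same sources. -/
lemma exists_exchange {E : Set (X × Y)} {π σ : Measure (X × Y)} [IsFiniteMeasure π]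
    [IsFiniteMeasure σ] (hπE : π Eᶜ = 0) (hπX : π.map Prod.fst = νX) (hσE : σ Eᶜ = 0)
    (hσX : σ.map Prod.fst ≤ νX) {H L : Set Y} (hHm : MeasurableSet H) (hLm : MeasurableSet L)
    {ε : ℝ≥0∞} (hε0 : ε ≠ 0) (hε1 : ε ≤ 1) :
    ∃ π₁ α β : Measure (X × Y), π₁ + α = π ∧ α ≤ ε • π ∧ β ≤ ε • σ ∧ π₁ + β ∈ Plans E νX ∧
      α Set.univ = β Set.univ ∧ α (Prod.snd ⁻¹' H)ᶜ = 0 ∧ β (Prod.snd ⁻¹' L)ᶜ = 0 ∧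
      (β = 0 → σ ({x | sendDensity νX π H x ≠ 0} ×ˢ L) = 0) := by
  have hεtop : ε ≠ ⊤ := ne_top_of_le_ne_top ENNReal.one_ne_top hε1
  obtain ⟨p, hp⟩ : ∃ p, p = sendDensity νX π H := ⟨_, rfl⟩
  obtain ⟨s, hs⟩ : ∃ s, s = sendDensity νX σ L := ⟨_, rfl⟩
  have hpm : Measurable p := hp ▸ measurable_sendDensity _ _ _
  have hsm : Measurable s := hs ▸ measurable_sendDensity _ _ _
  obtain ⟨gα, hgα⟩ : ∃ gα : X → ℝ≥0∞, gα = fun x => ε * min (s x) 1 := ⟨_, rfl⟩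
  obtain ⟨gβ, hgβ⟩ : ∃ gβ : X → ℝ≥0∞, gβ = fun x => ε * min (p x) 1 := ⟨_, rfl⟩
  have hgαm : Measurable gα := hgα ▸ (hsm.min measurable_const).const_mul ε
  have hgβm : Measurable gβ := hgβ ▸ (hpm.min measurable_const).const_mul ε
  have hgαε : ∀ x, gα x ≤ ε := fun x => by
    rw [hgα]
    exact mul_le_of_le_one_right' (min_le_right _ _)
  have hgβε : ∀ x, gβ x ≤ ε := fun x => by
    rw [hgβ]
    exact mul_le_of_le_one_right' (min_le_right _ _)
  obtain ⟨πH, hπH⟩ : ∃ πH, πH = π.restrict (Prod.snd ⁻¹' H) := ⟨_, rfl⟩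
  obtain ⟨σL, hσL⟩ : ∃ σL, σL = σ.restrict (Prod.snd ⁻¹' L) := ⟨_, rfl⟩
  have hπHle : πH ≤ π := hπH ▸ Measure.restrict_le_self
  have hσLle : σL ≤ σ := hσL ▸ Measure.restrict_le_self
  obtain ⟨α, hα⟩ : ∃ α, α = πH.withDensity (fun z => gα z.1) := ⟨_, rfl⟩
  obtain ⟨β, hβ⟩ : ∃ β, β = σL.withDensity (fun z => gβ z.1) := ⟨_, rfl⟩
  obtain ⟨π₁, hπ₁⟩ : ∃ π₁, π₁ = π.restrict (Prod.snd ⁻¹' H)ᶜ +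
      πH.withDensity (fun z => 1 - gα z.1) := ⟨_, rfl⟩
  have hαle : α ≤ ε • π := by
    rw [hα]
    have h : πH.withDensity (fun z => gα z.1) ≤ ε • πH :=
      withDensity_le_smul (g := fun z => gα z.1) πH fun z => hgαε z.1
    refine h.trans ?_
    gcongr
  have hβle : β ≤ ε • σ := by
    rw [hβ]
    have h : σL.withDensity (fun z => gβ z.1) ≤ ε • σL :=
      withDensity_le_smul (g := fun z => gβ z.1) σL fun z => hgβε z.1
    refine h.trans ?_
    gcongr
  have hadd : π₁ + α = π := by
    have h1 : πH.withDensity (fun z => 1 - gα z.1) + α = πH := by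
      have hm : Measurable fun z : X × Y => gα z.1 := hgαm.comp measurable_fst
      rw [hα, ← withDensity_add_right _ hm]
      have : ((fun z : X × Y => 1 - gα z.1) + fun z => gα z.1) = 1 := by
        funext z
        exact tsub_add_cancel_of_le ((hgαε z.1).trans hε1)
      rw [this, withDensity_one]
    rw [hπ₁, add_assoc, h1, hπH, add_comm, Measure.restrict_add_restrict_compl (measurable_snd hHm)]
  have hπ₁le : π₁ ≤ π := by
    rw [← hadd]
    exact Measure.le_add_right le_rfl
  have : IsFiniteMeasure (ε • π) := π.smul_finite hεtop
  have : IsFiniteMeasure (ε • σ) := σ.smul_finite hεtop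
  have : IsFiniteMeasure α := isFiniteMeasure_of_le _ hαle
  have : IsFiniteMeasure β := isFiniteMeasure_of_le _ hβle
  have : IsFiniteMeasure π₁ := isFiniteMeasure_of_le _ hπ₁le
  have hβX : β.map Prod.fst = νX.withDensity (s * gβ) := by
    rw [hβ, map_withDensity_comp _ measurable_fst hgβm, withDensity_mul _ hsm hgβm, hs, hσL,
      withDensity_sendDensity hσX]
  have hαβX : α.map Prod.fst = β.map Prod.fst := by
    rw [hβX, hα, map_withDensity_comp _ measurable_fst hgαm, hπH,
      ← withDensity_sendDensity hπX.le, ← hp, ← withDensity_mul _ hpm hgαm]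
    refine withDensity_congr_ae ?_
    filter_upwards [sendDensity_le_one (S := H) hπX.le, sendDensity_le_one (S := L) hσX]
      with x h1 h2
    simp only [Pi.mul_apply, hgα, hgβ, min_eq_left h1, min_eq_left h2, hp, hs]
    ring
  have hplan : π₁ + β ∈ Plans E νX := by
    refine ⟨inferInstance, ?_, ?_⟩
    · rw [Measure.add_apply, add_eq_zero]
      refine ⟨le_antisymm ((hπ₁le _).trans hπE.le) zero_le,
        le_antisymm ((hβle _).trans ?_) zero_le⟩
      simp [hσE]
    · rw [Measure.map_add _ _ measurable_fst, ← hαβX, ← Measure.map_add _ _ measurable_fst, hadd,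
        hπX]
  refine ⟨π₁, α, β, hadd, hαle, hβle, hplan, ?_, ?_, ?_, fun hβ0 => ?_⟩
  · simpa [Measure.map_apply measurable_fst] using
      congrArg (fun μ : Measure X => μ Set.univ) hαβX
  · rw [hα]
    refine withDensity_absolutelyContinuous _ _ ?_
    rw [hπH, Measure.restrict_apply (measurable_snd hHm).compl, Set.compl_inter_self,
      measure_empty]
  · rw [hβ]
    refine withDensity_absolutelyContinuous _ _ ?_
    rw [hσL, Measure.restrict_apply (measurable_snd hLm).compl, Set.compl_inter_self,
      measure_empty]
  · rw [hβ0, Measure.map_zero] at hβX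
    have hsp := (withDensity_eq_zero_iff (hsm.mul hgβm).aemeasurable).1 hβX.symm
    have hQ : MeasurableSet {x | p x ≠ 0} := (hpm (measurableSet_singleton 0)).compl
    rw [← hp, measure_prod_eq_setLIntegral_sendDensity hσX hQ,
      setLIntegral_eq_zero_iff hQ (measurable_sendDensity _ _ _)]
    filter_upwards [hsp] with x hx hpx
    have hmin0 : min (p x) 1 ≠ 0 := (lt_min (pos_iff_ne_zero.2 hpx) one_pos).ne'
    rw [← hs]
    simpa [hgβ, hε0, hmin0] using hx

/-- At a minimizer, no subplan can use the sources sending mass to high levels in order to feed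
lower levels. -/
lemma measure_prod_eq_zero_of_minimizer {E : Set (X × Y)} {νY : Measure Y} [IsFiniteMeasure νY]
    {θ : ℝ → EReal} (hθ : ProperConvexLSCOn θ) (hθs : StrictlyConvexOnDom θ)
    {π σ : Measure (X × Y)} (hπ : π ∈ Plans E νX)
    (hmin : ∀ π' ∈ Plans E νX, thetaDiv θ (π.map Prod.snd) νY ≤ thetaDiv θ (π'.map Prod.snd) νY)
    (hfin : thetaDiv θ (π.map Prod.snd) νY ≠ ⊤) {t δ : ℝ} (hδ : 0 < δ) (hδt : 2 * δ < t)
    (hσ : σ ∈ Feas E νX νY t) {H L : Set Y} (hHm : MeasurableSet H) (hLm : MeasurableSet L)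
    (hHL : Disjoint H L)
    (hH : ∀ᵐ y ∂νY, y ∈ H → ENNReal.ofReal t ≤ (π.map Prod.snd).rnDeriv νY y)
    (hL : ∀ᵐ y ∂νY, y ∈ L → (π.map Prod.snd).rnDeriv νY y ≤ ENNReal.ofReal (t - 2 * δ)) :
    σ ({x | sendDensity νX π H x ≠ 0} ×ˢ L) = 0 := by
  obtain ⟨hπfin, hπE, hπX⟩ := hπ
  obtain ⟨hσfin, hσE, hσX, hσY⟩ := hσ
  have ht : 0 < t := by linarith
  set ε : ℝ≥0∞ := ENNReal.ofReal (δ / t) with hε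
  have hε0 : ε ≠ 0 := by
    rw [hε, Ne, ENNReal.ofReal_eq_zero, not_le]
    positivity
  have hε1 : ε ≤ 1 := by
    rw [hε, ENNReal.ofReal_le_one, div_le_one ht]
    linarith
  have hεtop : ε ≠ ⊤ := ENNReal.ofReal_ne_top
  obtain ⟨π₁, α, β, hadd, hαle, hβle, hplan, hαβ, hαH, hβL, hβσ⟩ :=
    exists_exchange hπE hπX hσE hσX hHm hLm hε0 hε1
  have : IsFiniteMeasure (ε • π) := π.smul_finite hεtop
  have : IsFiniteMeasure (ε • σ) := σ.smul_finite hεtop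
  have : IsFiniteMeasure α := isFiniteMeasure_of_le _ hαle
  have : IsFiniteMeasure β := isFiniteMeasure_of_le _ hβle
  have : IsFiniteMeasure π₁ := isFiniteMeasure_of_le π (hadd ▸ Measure.le_add_right le_rfl)
  obtain ⟨P₁, hP₁⟩ : ∃ P₁, P₁ = π₁.map Prod.snd := ⟨_, rfl⟩
  obtain ⟨A, hA⟩ : ∃ A, A = α.map Prod.snd := ⟨_, rfl⟩
  obtain ⟨B, hB⟩ : ∃ B, B = β.map Prod.snd := ⟨_, rfl⟩
  have : IsFiniteMeasure P₁ := hP₁ ▸ inferInstance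
  have : IsFiniteMeasure A := hA ▸ inferInstance
  have : IsFiniteMeasure B := hB ▸ inferInstance
  have hPA : π.map Prod.snd = P₁ + A := by
    rw [hP₁, hA, ← Measure.map_add _ _ measurable_snd, hadd]
  have hPB : (π₁ + β).map Prod.snd = P₁ + B := by
    rw [hP₁, hB, Measure.map_add _ _ measurable_snd]
  have hAle : A ≤ ε • (P₁ + A) := by
    rw [← hPA, hA, ← Measure.map_smul]
    exact Measure.map_mono hαle measurable_snd
  have hBle : B ≤ ENNReal.ofReal δ • νY := by
    have h1 : B ≤ ε • σ.map Prod.snd := by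
      rw [hB, ← Measure.map_smul]
      exact Measure.map_mono hβle measurable_snd
    refine h1.trans ?_
    have h2 : ENNReal.ofReal δ = ε * ENNReal.ofReal t := by
      rw [hε, ← ENNReal.ofReal_mul (by positivity), div_mul_cancel₀ _ ht.ne']
    rw [h2, ← smul_smul]
    gcongr
  have hBν : B ≪ νY := (Measure.absolutelyContinuous_of_le hBle).trans
    Measure.smul_absolutelyContinuous
  have hAH : A Hᶜ = 0 := by
    rwa [hA, Measure.map_apply measurable_snd hHm.compl, Set.preimage_compl]
  have hBL : B Lᶜ = 0 := by
    rwa [hB, Measure.map_apply measurable_snd hLm.compl, Set.preimage_compl]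
  have hAB : A Set.univ = B Set.univ := by
    simpa [hA, hB, Measure.map_apply measurable_snd] using hαβ
  have haH := ae_rnDeriv_eq_zero_of_measure_eq_zero (ν := νY) hHm.compl hAH
  have hbL := ae_rnDeriv_eq_zero_of_measure_eq_zero (ν := νY) hLm.compl hBL
  have hle := hmin _ hplan
  rw [hPA] at hH hL hfin hle
  rw [hPB] at hle
  have hB0 : B = 0 := by
    refine eq_zero_of_thetaDiv_le hθ hθs (u := t - δ) hBν hAB ?_ ?_ hfin hle
    · filter_upwards [haH, hH, rnDeriv_le_smul (ν := νY) hεtop hAle,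
        Measure.rnDeriv_add P₁ A νY, Measure.rnDeriv_ne_top (P₁ + A) νY] with y h1 h2 h3 h4 h5 hy
      have hyH : y ∈ H := by
        by_contra hyH
        exact hy (h1 hyH)
      have h2 := h2 hyH
      rw [h4, Pi.add_apply] at h2 h3 h5
      have ha := (ENNReal.add_ne_top.1 h5).2
      have hr := (ENNReal.add_ne_top.1 h5).1
      generalize A.rnDeriv νY y = a at *
      generalize P₁.rnDeriv νY y = r at *
      lift a to ℝ≥0 using ha
      lift r to ℝ≥0 using hr
      have e2 : t ≤ r + a := by
        have := (ENNReal.ofReal_le_iff_le_toReal h5).1 h2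
        simpa [ENNReal.toReal_add] using this
      have e3 : (a : ℝ) ≤ δ / t * (r + a) := by
        have := ENNReal.toReal_mono (ENNReal.mul_ne_top hεtop h5) h3
        rw [ENNReal.toReal_mul, hε, ENNReal.toReal_ofReal (by positivity)] at this
        simpa [ENNReal.toReal_add] using this
      refine (ENNReal.ofReal_le_iff_le_toReal ENNReal.coe_ne_top).2 ?_
      rw [ENNReal.coe_toReal]
      have e4 : (1 - δ / t) * t ≤ (1 - δ / t) * (r + a) := by
        refine mul_le_mul_of_nonneg_left e2 (sub_nonneg.2 ?_)
        rw [div_le_one ht]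
        linarith
      have e5 : (1 - δ / t) * t = t - δ := by field_simp
      linarith
    · filter_upwards [haH, hbL, hL, rnDeriv_le_smul (ν := νY) ENNReal.ofReal_ne_top hBle,
        Measure.rnDeriv_add P₁ A νY, Measure.rnDeriv_self νY] with y h1 h2 h3 h4 h5 h6 hy
      have hyL : y ∈ L := by
        by_contra hyL
        exact hy (h2 hyL)
      have ha := h1 fun hyH => Set.disjoint_left.1 hHL hyH hyL
      refine ⟨ha, ?_⟩
      have h3 := h3 hyL
      rw [h5, Pi.add_apply, ha, add_zero] at h3
      rw [h6, mul_one] at h4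
      calc _ ≤ ENNReal.ofReal (t - 2 * δ) + ENNReal.ofReal δ := add_le_add h3 h4
        _ = ENNReal.ofReal (t - δ) := by
          rw [← ENNReal.ofReal_add (by linarith) hδ.le]
          congr 1
          ring
  refine hβσ ?_
  rw [← Measure.measure_univ_eq_zero]
  simpa [hB, Measure.map_apply measurable_snd] using
    congrArg (fun μ : Measure Y => μ Set.univ) hB0

end Exchange

section Levels

variable {E : Set (X × Y)} {νX : Measure X} {νY : Measure Y} [IsFiniteMeasure νY]
  {π : Measure (X × Y)}

/-- Cutting a plan down to level `t` gives a feasible subplan. -/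
lemma lintegral_min_rnDeriv_le_fit (hπ : π ∈ Plans E νX) (t : ℝ) :
    ∫⁻ y, min ((π.map Prod.snd).rnDeriv νY y) (ENNReal.ofReal t) ∂νY ≤ Fit E νX νY t := by
  obtain ⟨hπfin, hπE, hπX⟩ := hπ
  set P := π.map Prod.snd with hP
  have hrm := Measure.measurable_rnDeriv P νY
  obtain ⟨N, hNm, hN, hNν⟩ := Measure.mutuallySingular_singularPart P νY
  set h : Y → ℝ≥0∞ := N.indicator fun y => min 1 (ENNReal.ofReal t / P.rnDeriv νY y) with hh
  have hm : Measurable h :=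
    (measurable_const.min (measurable_const.div hrm)).indicator hNm
  have hle : ∀ y, h y ≤ 1 := by
    intro y
    rw [hh]
    exact Set.indicator_le (fun _ _ => min_le_left _ _) y
  have hsing : (P.singularPart νY).withDensity h = 0 := by
    refine (withDensity_eq_zero_iff hm.aemeasurable).2 ?_
    have : ∀ᵐ y ∂P.singularPart νY, y ∉ N := measure_eq_zero_iff_ae_notMem.1 hN
    filter_upwards [this] with y hy
    simp [hh, hy]
  have hPh : P.withDensity h = νY.withDensity
      fun y => min (P.rnDeriv νY y) (ENNReal.ofReal t) := by
    conv_lhs => rw [P.haveLebesgueDecomposition_add νY]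
    rw [withDensity_add_measure, hsing, zero_add, ← withDensity_mul _ hrm hm]
    refine withDensity_congr_ae ?_
    have : ∀ᵐ y ∂νY, y ∉ Nᶜ := measure_eq_zero_iff_ae_notMem.1 hNν
    filter_upwards [this, Measure.rnDeriv_ne_top P νY] with y hy hr
    rw [Set.notMem_compl_iff] at hy
    simp only [Pi.mul_apply, hh, Set.indicator_of_mem hy]
    rcases eq_or_ne (P.rnDeriv νY y) 0 with h0 | h0
    · simp [h0]
    · rw [mul_min, mul_one, ENNReal.mul_div_cancel h0 hr]
  have hσle : π.withDensity (fun z => h z.2) ≤ π := by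
    simpa using withDensity_le_smul (g := fun z => h z.2) π fun z => hle z.2
  have hσY : (π.withDensity fun z => h z.2).map Prod.snd = νY.withDensity
      fun y => min (P.rnDeriv νY y) (ENNReal.ofReal t) := by
    rw [map_withDensity_comp _ measurable_snd hm, ← hP, hPh]
  have hfeas : π.withDensity (fun z => h z.2) ∈ Feas E νX νY t := by
    refine ⟨isFiniteMeasure_of_le _ hσle, le_antisymm ((hσle _).trans hπE.le) zero_le,
      (Measure.map_mono hσle measurable_fst).trans hπX.le, ?_⟩
    rw [hσY]
    exact withDensity_le_smul _ fun _ => min_le_right _ _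
  calc _ = (π.withDensity fun z => h z.2) Set.univ := by
        rw [← Set.preimage_univ (f := Prod.snd), ← Measure.map_apply measurable_snd .univ, hσY,
          withDensity_apply _ .univ, Measure.restrict_univ]
    _ ≤ _ := le_iSup₂ (f := fun σ (_ : σ ∈ Feas E νX νY t) => σ Set.univ) _ hfeas

/-- At a minimizer, every capped subplan has at most the truncated mass. -/
lemma fit_le_lintegral_min_rnDeriv [IsFiniteMeasure νX] {θ : ℝ → EReal}
    (hθ : ProperConvexLSCOn θ) (hθs : StrictlyConvexOnDom θ) (hπ : π ∈ Plans E νX)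
    (hmin : ∀ π' ∈ Plans E νX, thetaDiv θ (π.map Prod.snd) νY ≤ thetaDiv θ (π'.map Prod.snd) νY)
    (hfin : thetaDiv θ (π.map Prod.snd) νY ≠ ⊤) {t : ℝ} (ht : 0 < t) :
    Fit E νX νY t ≤ ∫⁻ y, min ((π.map Prod.snd).rnDeriv νY y) (ENNReal.ofReal t) ∂νY := by
  refine iSup₂_le fun σ hσ => ?_
  have hπfin : IsFiniteMeasure π := hπ.1
  have hπX := hπ.2.2
  have hσX := hσ.2.2.1
  have hσY := hσ.2.2.2
  obtain ⟨r, hr⟩ : ∃ r, r = (π.map Prod.snd).rnDeriv νY := ⟨_, rfl⟩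
  have hrm : Measurable r := hr ▸ Measure.measurable_rnDeriv _ _
  obtain ⟨N, hNm, hN, hNν⟩ := Measure.mutuallySingular_singularPart (π.map Prod.snd) νY
  have hNae : ∀ᵐ y ∂νY, y ∉ Nᶜ := measure_eq_zero_iff_ae_notMem.1 hNν
  set H : Set Y := Nᶜ ∪ {y | ENNReal.ofReal t ≤ r y} with hH
  have hHm : MeasurableSet H := hNm.compl.union (measurableSet_le measurable_const hrm)
  have hHr : ∀ᵐ y ∂νY, y ∈ H → ENNReal.ofReal t ≤ r y := by
    filter_upwards [hNae] with y hy hyH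
    exact hyH.resolve_left hy
  set Q : Set X := {x | sendDensity νX π H x ≠ 0} with hQ
  have hQm : MeasurableSet Q :=
    (measurable_sendDensity νX π H (measurableSet_singleton 0)).compl
  have hσQ : σ (Q ×ˢ Hᶜ) = 0 := by
    set δ : ℕ → ℝ := fun n => t / (n + 3) with hδ
    have hcover : Hᶜ ⊆ ⋃ n, Hᶜ ∩ {y | r y ≤ ENNReal.ofReal (t - 2 * δ n)} := by
      intro y hy
      have hyt : r y < ENNReal.ofReal t := by
        by_contra hyt
        exact hy (Or.inr (not_lt.1 hyt))
      have hlim : Tendsto (fun n => ENNReal.ofReal (t - 2 * δ n)) atTop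
          (nhds (ENNReal.ofReal t)) := by
        refine ENNReal.tendsto_ofReal ?_
        have h1 : Tendsto δ atTop (nhds 0) :=
          tendsto_const_nhds.div_atTop
            (tendsto_atTop_add_const_right _ _ tendsto_natCast_atTop_atTop)
        simpa using tendsto_const_nhds.sub (h1.const_mul 2)
      obtain ⟨n, hn⟩ := (hlim.eventually (lt_mem_nhds hyt)).exists
      exact Set.mem_iUnion.2 ⟨n, hy, hn.le⟩
    have hsub : Q ×ˢ Hᶜ ⊆ ⋃ n, Q ×ˢ (Hᶜ ∩ {y | r y ≤ ENNReal.ofReal (t - 2 * δ n)}) := by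
      rw [← Set.prod_iUnion]
      exact Set.prod_mono le_rfl hcover
    refine measure_mono_null hsub (measure_iUnion_null fun n => ?_)
    have hn : (0 : ℝ) < n + 3 := by positivity
    refine measure_prod_eq_zero_of_minimizer hθ hθs hπ hmin hfin (t := t) (δ := δ n)
      (div_pos ht hn) ?_ hσ hHm (hHm.compl.inter (measurableSet_le hrm measurable_const))
      (disjoint_compl_right.mono_right Set.inter_subset_left) (hr ▸ hHr)
      (hr ▸ ae_of_all _ fun y hy => hy.2)
    rw [hδ, ← mul_div_assoc, div_lt_iff₀ hn]
    nlinarith [mul_nonneg ht.le (Nat.cast_nonneg (α := ℝ) n)]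
  have hπQ : π (Qᶜ ×ˢ H) = 0 := by
    rw [measure_prod_eq_setLIntegral_sendDensity hπX.le hQm.compl,
      setLIntegral_eq_zero_iff hQm.compl (measurable_sendDensity _ _ _)]
    exact ae_of_all _ fun x hx => not_not.1 hx
  have hsplit : ∀ (μ : Measure (X × Y)) (S : Set X),
      μ (Prod.fst ⁻¹' S) ≤ μ (S ×ˢ H) + μ (S ×ˢ Hᶜ) := by
    intro μ S
    rw [← Set.prod_univ, ← Set.union_compl_self H, Set.prod_union]
    exact measure_union_le _ _
  have hσH : σ (Prod.snd ⁻¹' H) ≤ ENNReal.ofReal t * νY H := by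
    rw [← Measure.map_apply measurable_snd hHm]
    exact hσY H
  have hπH : π (Prod.snd ⁻¹' Hᶜ) = ∫⁻ y in Hᶜ, r y ∂νY := by
    rw [← Measure.map_apply measurable_snd hHm.compl]
    have h0 : (π.map Prod.snd).singularPart νY Hᶜ = 0 :=
      measure_mono_null (by rw [hH, Set.compl_union, compl_compl]; exact Set.inter_subset_left) hN
    conv_lhs => rw [(π.map Prod.snd).haveLebesgueDecomposition_add νY]
    rw [Measure.add_apply, h0, zero_add, withDensity_apply _ hHm.compl, hr]
  have hσc : σ (Prod.fst ⁻¹' Qᶜ) ≤ ∫⁻ y in Hᶜ, r y ∂νY := by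
    rw [← Measure.map_apply measurable_fst hQm.compl, ← hπH]
    refine (hσX _).trans ?_
    rw [← hπX, Measure.map_apply measurable_fst hQm.compl]
    refine (hsplit π Qᶜ).trans ?_
    rw [hπQ, zero_add]
    exact measure_mono fun z hz => hz.2
  have huniv : (Set.univ : Set (X × Y)) ⊆
      Prod.snd ⁻¹' H ∪ Q ×ˢ Hᶜ ∪ Prod.fst ⁻¹' Qᶜ := by
    rintro z -
    by_cases h1 : z.2 ∈ H
    · exact Or.inl (Or.inl h1)
    · by_cases h2 : z.1 ∈ Q
      · exact Or.inl (Or.inr ⟨h2, h1⟩)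
      · exact Or.inr h2
  calc σ Set.univ ≤ σ (Prod.snd ⁻¹' H) + σ (Q ×ˢ Hᶜ) + σ (Prod.fst ⁻¹' Qᶜ) :=
        (measure_mono huniv).trans
          ((measure_union_le _ _).trans (add_le_add_left (measure_union_le _ _) _))
    _ ≤ ENNReal.ofReal t * νY H + ∫⁻ y in Hᶜ, r y ∂νY := by
        rw [hσQ, add_zero]
        exact add_le_add hσH hσc
    _ = (∫⁻ y in H, min (r y) (ENNReal.ofReal t) ∂νY) +
          ∫⁻ y in Hᶜ, min (r y) (ENNReal.ofReal t) ∂νY := by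
        congr 1
        · rw [← setLIntegral_const]
          refine setLIntegral_congr_fun_ae hHm ?_
          filter_upwards [hHr] with y hy hyH
          rw [min_eq_right (hy hyH)]
        · refine setLIntegral_congr_fun hHm.compl fun y hy => ?_
          have hyt : r y ≤ ENNReal.ofReal t := by
            by_contra hyt
            exact hy (Or.inr (not_le.1 hyt).le)
          exact (min_eq_left hyt).symm
    _ = _ := by rw [lintegral_add_compl _ hHm, hr]

end Levels

theorem strict_convex_implies_level_opt_maximin
    [TopologicalSpace X] [PolishSpace X] [BorelSpace X]
    [TopologicalSpace Y] [PolishSpace Y] [BorelSpace Y]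
    (E : Set (X × Y)) (hE : IsClosed E)
    (νX : Measure X) (νY : Measure Y) [IsFiniteMeasure νX] [IsFiniteMeasure νY]
    (hνX : 0 < νX Set.univ) (hνY : 0 < νY Set.univ)
    (hNbhdX : ∀ x : X, ∃ y : Y, (x, y) ∈ E) (hNbhdY : ∀ y : Y, ∃ x : X, (x, y) ∈ E)
    (θ : ℝ → EReal) (hθ : ProperConvexLSCOn θ) (hθstrict : StrictlyConvexOnDom θ)
    (πs : Measure (X × Y)) (hπs : πs ∈ Plans E νX)
    (hmin : thetaDiv θ (πs.map Prod.snd) νY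
        = sInf {d : EReal | ∃ π ∈ Plans E νX, d = thetaDiv θ (π.map Prod.snd) νY})
    (hfin : thetaDiv θ (πs.map Prod.snd) νY ≠ ⊤) :
    LevelOptMaximin E νX νY πs := by
  have hle : ∀ π ∈ Plans E νX,
      thetaDiv θ (πs.map Prod.snd) νY ≤ thetaDiv θ (π.map Prod.snd) νY :=
    fun π hπ => hmin.le.trans (sInf_le ⟨π, hπ, rfl⟩)
  intro t ht
  exact le_antisymm (lintegral_min_rnDeriv_le_fit hπs t)
    (fit_le_lintegral_min_rnDeriv hθ hθstrict hπs hle hfin ht)
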